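/- For every finite-state finite-transition probabilistic automaton A, there exists an equivalence relation R on its state set S such that for all states s, t ∈ S: s ∼paa t if and only if (s,t) ∈ R, L(s) = L(t), and CT_R(s) = CT_R(t), where CT_R(u) denotes the convex hull of the class-lifted target distributions of the transitions enabled at u. -/

import Mathlib

open scoped Classical

noncomputable section

/-- A function `δ : S → ℝ` is a discrete probability distribution on the finite set `S`. -/
def IsDist {S : Type*} [Fintype S] (δ : S → ℝ) : Prop :=
  (∀ s, 0 ≤ δ s) ∧ ∑ s, δ s = 1

/-- The probability assigned by `δ` to the `R`-equivalence class of `x`. -/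
def classSum {S : Type*} [Fintype S] (R : S → S → Prop) (δ : S → ℝ) (x : S) : ℝ :=
  ∑ y, if R x y then δ y else 0

/-- Lifting `L(R)` of a relation `R` to distributions: `δ₁ L(R) δ₂` iff `δ₁(C) = δ₂(C)`
for every equivalence class `C` of `R`. -/
def Lift {S : Type*} [Fintype S] (R : S → S → Prop) (δ₁ δ₂ : S → ℝ) : Prop :=
  ∀ x, classSum R δ₁ x = classSum R δ₂ x

/-- An action agnostic probabilistic automaton. -/
structure PA (S : Type*) (AP : Type*) where
  start : S
  label : S → Set AP
  trans : Set (S × (S → ℝ))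

/-- Well-formedness of a PA: the transition relation is finite and all targets are
discrete probability distributions. -/
def PA.WF {S AP : Type*} [Fintype S] (A : PA S AP) : Prop :=
  A.trans.Finite ∧ ∀ p ∈ A.trans, IsDist p.2

/-- Combined transition `s ⟶_C δ`: `δ` is a finite convex combination of targets of
transitions enabled at `s`. -/
def PA.ctrans {S AP : Type*} (A : PA S AP) (s : S) (δ : S → ℝ) : Prop :=
  ∃ (n : ℕ) (p : Fin n → ℝ) (η : Fin n → S → ℝ),
    (∀ i, 0 ≤ p i) ∧ (∀ i, (s, η i) ∈ A.trans) ∧ ∑ i, p i = 1 ∧ δ = ∑ i, p i • η i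

/-- Probabilistic bisimulation on a PA. -/
def PA.IsBisim {S AP : Type*} [Fintype S] (A : PA S AP) (R : S → S → Prop) : Prop :=
  Equivalence R ∧ ∀ s t, R s t → A.label s = A.label t ∧
    ∀ δ, (s, δ) ∈ A.trans → ∃ η, A.ctrans t η ∧ Lift R δ η

/-- Two states of a PA are probabilistically bisimilar. -/
def PA.bisimStates {S AP : Type*} [Fintype S] (A : PA S AP) (s t : S) : Prop :=
  ∃ R, A.IsBisim R ∧ R s t

/-- Disjoint union of two PAs. -/
def PA.disjUnion {S₁ S₂ AP : Type*} (A₁ : PA S₁ AP) (A₂ : PA S₂ AP) : PA (S₁ ⊕ S₂) AP where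
  start := Sum.inl A₁.start
  label := Sum.elim A₁.label A₂.label
  trans :=
    (fun q : S₁ × (S₁ → ℝ) => ((Sum.inl q.1 : S₁ ⊕ S₂), Sum.elim q.2 fun _ => (0 : ℝ))) '' A₁.trans ∪
    (fun q : S₂ × (S₂ → ℝ) => ((Sum.inr q.1 : S₁ ⊕ S₂), Sum.elim (fun _ => (0 : ℝ)) q.2)) '' A₂.trans

/-- Two PAs are probabilistically bisimilar (`∼paa`): some probabilistic bisimulation on
their disjoint union relates their start states. -/
def PA.Bisimilar {S₁ S₂ AP : Type*} [Fintype S₁] [Fintype S₂]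
    (A₁ : PA S₁ AP) (A₂ : PA S₂ AP) : Prop :=
  ∃ R, (A₁.disjUnion A₂).IsBisim R ∧ R (Sum.inl A₁.start) (Sum.inr A₂.start)

/-- Product of two distributions. -/
def distProd {S₁ S₂ : Type*} (δ₁ : S₁ → ℝ) (δ₂ : S₂ → ℝ) : S₁ × S₂ → ℝ :=
  fun p => δ₁ p.1 * δ₂ p.2

/-- Synchronous product of PAs. -/
def PA.syncProd {S₁ S₂ AP : Type*} (A₁ : PA S₁ AP) (A₂ : PA S₂ AP) : PA (S₁ × S₂) AP where
  start := (A₁.start, A₂.start)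
  label := fun p => A₁.label p.1 ∪ A₂.label p.2
  trans := {p | ∃ q₁ ∈ A₁.trans, ∃ q₂ ∈ A₂.trans, p = ((q₁.1, q₂.1), distProd q₁.2 q₂.2)}

/-- An interval Markov decision process: intervals are given by their lower and upper
bound functions. -/
structure IMDP (S : Type*) (Act : Type*) (AP : Type*) where
  start : S
  label : S → Set AP
  low : S → Act → S → ℝ
  high : S → Act → S → ℝ

/-- The set of enabled actions of a state: those `a` with `I(s,a,s') ≠ [0,0]` for some `s'`. -/
def IMDP.enabled {S Act AP : Type*} (M : IMDP S Act AP) (s : S) : Set Act :=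
  {a | ∃ s', ¬ (M.low s a s' = 0 ∧ M.high s a s' = 0)}

/-- The uncertainty set `ℋ^a_s` of feasible successor distributions. -/
def IMDP.unc {S Act AP : Type*} [Fintype S] (M : IMDP S Act AP) (s : S) (a : Act) :
    Set (S → ℝ) :=
  {δ | IsDist δ ∧ ∀ s', δ s' ∈ Set.Icc (M.low s a s') (M.high s a s')}

/-- Well-formedness of an IMDP: intervals are closed subintervals of `[0,1]`, each state
has an enabled action, and each uncertainty set of an enabled action is nonempty. -/
def IMDP.WF {S Act AP : Type*} [Fintype S] (M : IMDP S Act AP) : Prop :=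
  (∀ s a s', 0 ≤ M.low s a s' ∧ M.low s a s' ≤ M.high s a s' ∧ M.high s a s' ≤ 1) ∧
  (∀ s, (M.enabled s).Nonempty) ∧
  (∀ s, ∀ a ∈ M.enabled s, (M.unc s a).Nonempty)

/-- Cooperative transition `s ⟶ δ`: `δ` lies in the convex hull of the union of the
uncertainty sets of the enabled actions of `s`. -/
def IMDP.trans {S Act AP : Type*} [Fintype S] (M : IMDP S Act AP) (s : S) (δ : S → ℝ) :
    Prop :=
  δ ∈ convexHull ℝ (⋃ a ∈ M.enabled s, M.unc s a)

/-- Probabilistic bisimulation on an IMDP (cooperative semantics). -/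
def IMDP.IsBisim {S Act AP : Type*} [Fintype S] (M : IMDP S Act AP) (R : S → S → Prop) :
    Prop :=
  Equivalence R ∧ ∀ s t, R s t → M.label s = M.label t ∧
    ∀ δ, M.trans s δ → ∃ η, M.trans t η ∧ Lift R δ η

/-- Two states of an IMDP are probabilistically bisimilar (`∼c`). -/
def IMDP.bisimStates {S Act AP : Type*} [Fintype S] (M : IMDP S Act AP) (s t : S) : Prop :=
  ∃ R, M.IsBisim R ∧ R s t

/-- Disjoint union of two IMDPs. -/
def IMDP.disjUnion {S₁ S₂ Act₁ Act₂ AP : Type*}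
    (M₁ : IMDP S₁ Act₁ AP) (M₂ : IMDP S₂ Act₂ AP) : IMDP (S₁ ⊕ S₂) (Act₁ ⊕ Act₂) AP where
  start := Sum.inl M₁.start
  label := Sum.elim M₁.label M₂.label
  low := fun s a t =>
    match s, a, t with
    | Sum.inl s, Sum.inl a, Sum.inl t => M₁.low s a t
    | Sum.inr s, Sum.inr a, Sum.inr t => M₂.low s a t
    | _, _, _ => 0
  high := fun s a t =>
    match s, a, t with
    | Sum.inl s, Sum.inl a, Sum.inl t => M₁.high s a t
    | Sum.inr s, Sum.inr a, Sum.inr t => M₂.high s a t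
    | _, _, _ => 0

/-- Two IMDPs are probabilistically bisimilar (`∼c`): some probabilistic bisimulation on
their disjoint union relates their initial states. -/
def IMDP.Bisimilar {S₁ S₂ Act₁ Act₂ AP : Type*} [Fintype S₁] [Fintype S₂]
    (M₁ : IMDP S₁ Act₁ AP) (M₂ : IMDP S₂ Act₂ AP) : Prop :=
  ∃ R, (M₁.disjUnion M₂).IsBisim R ∧ R (Sum.inl M₁.start) (Sum.inr M₂.start)

/-- Unfolding `UF` of an IMDP as a PA: transitions are the extreme points of the
uncertainty sets of enabled actions. -/
def IMDP.unfold {S Act AP : Type*} [Fintype S] (M : IMDP S Act AP) : PA S AP where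
  start := M.start
  label := M.label
  trans := {p | ∃ a ∈ M.enabled p.1, p.2 ∈ (M.unc p.1 a).extremePoints ℝ}

/-- Folding `F` of a PA as an IMDP with a single action: `I(s,f,t)` is the interval
`[min, max]` of the coordinate-`t` projection of the convex hull of the targets of the
transitions enabled at `s`. -/
def PA.fold {S AP : Type*} [Fintype S] (A : PA S AP) : IMDP S Unit AP where
  start := A.start
  label := A.label
  low := fun s _ t => sInf ((fun δ => δ t) '' convexHull ℝ {η | (s, η) ∈ A.trans})
  high := fun s _ t => sSup ((fun δ => δ t) '' convexHull ℝ {η | (s, η) ∈ A.trans})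

/-- Synchronous product of IMDPs: `M₁ ⊗ M₂ = F(UF(M₁) ⊗ UF(M₂))`. -/
def IMDP.syncProd {S₁ S₂ Act₁ Act₂ AP : Type*} [Fintype S₁] [Fintype S₂]
    (M₁ : IMDP S₁ Act₁ AP) (M₂ : IMDP S₂ Act₂ AP) : IMDP (S₁ × S₂) Unit AP :=
  (M₁.unfold.syncProd M₂.unfold).fold

/-- Interleaved composition `M_l ||| M_r` of IMDPs. -/
def IMDP.interleave {S₁ S₂ Act₁ Act₂ AP : Type*}
    (Ml : IMDP S₁ Act₁ AP) (Mr : IMDP S₂ Act₂ AP) : IMDP (S₁ × S₂) (Act₁ ⊕ Act₂) AP where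
  start := (Ml.start, Mr.start)
  label := fun p => Ml.label p.1 ∪ Mr.label p.2
  low := fun s a t =>
    match a with
    | Sum.inl a => if t.2 = s.2 then Ml.low s.1 a t.1 else 0
    | Sum.inr a => if t.1 = s.1 then Mr.low s.2 a t.2 else 0
  high := fun s a t =>
    match a with
    | Sum.inl a => if t.2 = s.2 then Ml.high s.1 a t.1 else 0
    | Sum.inr a => if t.1 = s.1 then Mr.high s.2 a t.2 else 0

/-- The polytope `CT_R(u)` of class-lifted target distributions of the transitions
enabled at `u`, represented by the map `x ↦ δ([x]_R)` in `ℝ^S`. -/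
def PA.CT {S AP : Type*} [Fintype S] (A : PA S AP) (R : S → S → Prop) (u : S) :
    Set (S → ℝ) :=
  convexHull ℝ ((fun δ => classSum R δ) '' {δ | (u, δ) ∈ A.trans})

/-- The class-lifted distribution `[δ]_R ∈ Disc(S/R)`. -/
def qlift {S : Type*} [Fintype S] (R : Setoid S) (δ : S → ℝ) : Quotient R → ℝ :=
  fun C => ∑ y, if Quotient.mk R y = C then δ y else 0

/-- The polytope `CT_R(u)` of class-lifted target distributions, as a subset of
`ℝ^(S/R)`. -/
def PA.CTq {S AP : Type*} [Fintype S] (A : PA S AP) (R : Setoid S) (u : S) :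
    Set (Quotient R → ℝ) :=
  convexHull ℝ (qlift R '' {δ | (u, δ) ∈ A.trans})

/-- The coordinate-`C` projection interval `[min, max]` of a polytope `P ⊆ ℝ^Q`. -/
def projInterval {Q : Type*} (P : Set (Q → ℝ)) (C : Q) : Set ℝ :=
  Set.Icc (sInf ((fun f => f C) '' P)) (sSup ((fun f => f C) '' P))

/-- The box `∏_C proj_C(P)` in `ℝ^Q` formed by the coordinate projection intervals. -/
def projBox {Q : Type*} (P : Set (Q → ℝ)) : Set (Q → ℝ) :=
  {f | ∀ C, f C ∈ projInterval P C}

/-- The standard probability simplex in `ℝ^Q`. -/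
def stdSimplex' (Q : Type*) : Set (Q → ℝ) :=
  {f | (∀ C, 0 ≤ f C) ∧ ∑ᶠ C, f C = 1}

/-- The product relation `R × id_Y` on `X × Y`. -/
def prodIdRel {X Y : Type*} (R : X → X → Prop) : (X × Y) → (X × Y) → Prop :=
  fun p q => R p.1 q.1 ∧ p.2 = q.2

end

/-- Forming class sums, as a linear map. -/
noncomputable def classSumLinear {S : Type*} [Fintype S] (R : S → S → Prop) :
    (S → ℝ) →ₗ[ℝ] (S → ℝ) where
  toFun := classSum R
  map_add' δ₁ δ₂ := by
    ext x
    simp only [classSum, Pi.add_apply, ← Finset.sum_add_distrib]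
    exact Finset.sum_congr rfl fun y _ => by split_ifs <;> simp
  map_smul' c δ := by
    ext x
    simp [classSum, Finset.mul_sum]

theorem Lift.mono {S : Type*} [Fintype S] {R R' : S → S → Prop} (hR : Equivalence R)
    (hR' : Equivalence R') (hle : ∀ s t, R' s t → R s t) {δ₁ δ₂ : S → ℝ}
    (h : Lift R' δ₁ δ₂) : Lift R δ₁ δ₂ := by
  let r : Setoid S := ⟨R', hR'⟩
  have key (δ : S → ℝ) (x : S) : classSum R δ x =
      ∑ C : Quotient r, if R x C.out then classSum R' δ C.out else 0 := by
    rw [classSum, ← Finset.sum_fiberwise Finset.univ (fun y => (Quotient.mk r y))]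
    refine Finset.sum_congr rfl fun C _ => ?_
    rw [Finset.sum_filter]
    have out_iff (y : S) : Quotient.mk r y = C ↔ R' C.out y := by
      rw [eq_comm]
      nth_rewrite 1 [← Quotient.out_eq C]
      exact Quotient.eq
    split_ifs with hx
    · refine Finset.sum_congr rfl fun y _ => ?_
      by_cases hy : R' C.out y
      · simp [(out_iff y).2 hy, hy, hR.trans hx (hle _ _ hy)]
      · simp [out_iff y, hy]
    · refine Finset.sum_eq_zero fun y _ => ?_
      by_cases hy : R' C.out y
      · have hxy : ¬ R x y := fun hxy => hx (hR.trans hxy (hR.symm (hle _ _ hy)))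
        simp [hxy]
      · simp [out_iff y, hy]
  intro x
  simp only [key, h _]

theorem PA.ctrans_iff_mem_convexHull {S AP : Type*} (A : PA S AP) (s : S) (δ : S → ℝ) :
    A.ctrans s δ ↔ δ ∈ convexHull ℝ {η | (s, η) ∈ A.trans} := by
  constructor
  · rintro ⟨n, p, η, hp, hη, hsum, rfl⟩
    exact (convex_convexHull ℝ _).sum_mem (fun i _ => hp i) hsum
      fun i _ => subset_convexHull ℝ _ (hη i)
  · intro h
    obtain ⟨ι, _, w, z, hw, hsum, hz, rfl⟩ := mem_convexHull_iff_exists_fintype.1 h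
    let e := (Fintype.equivFin ι).symm
    exact ⟨Fintype.card ι, w ∘ e, z ∘ e, fun i => hw _, fun i => hz _,
      (e.sum_comp w).trans hsum, (e.sum_comp fun i => w i • z i).symm⟩

theorem PA.mem_CT_iff {S AP : Type*} [Fintype S] (A : PA S AP) (R : S → S → Prop) (s : S)
    (f : S → ℝ) : f ∈ A.CT R s ↔ ∃ η, A.ctrans s η ∧ classSum R η = f := by
  have h : A.CT R s = classSumLinear R '' convexHull ℝ {η | (s, η) ∈ A.trans} :=
    ((classSumLinear R).image_convexHull _).symm
  simp only [h, Set.mem_image, A.ctrans_iff_mem_convexHull]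
  rfl

theorem PA.CT_subset_CT_iff {S AP : Type*} [Fintype S] (A : PA S AP) (R : S → S → Prop)
    (s t : S) : A.CT R s ⊆ A.CT R t ↔
      ∀ δ, (s, δ) ∈ A.trans → ∃ η, A.ctrans t η ∧ Lift R δ η := by
  have hconv : Convex ℝ (A.CT R t) := convex_convexHull ℝ _
  rw [PA.CT, hconv.convexHull_subset_iff, Set.image_subset_iff]
  refine forall₂_congr fun δ _ => ?_
  refine (A.mem_CT_iff R t _).trans (exists_congr fun η => and_congr_right fun _ => ?_)
  rw [eq_comm, funext_iff]
  rfl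

theorem PA.IsBisim.CT_eq_of_le {S AP : Type*} [Fintype S] {A : PA S AP} {R R' : S → S → Prop}
    (hR' : A.IsBisim R') (hR : Equivalence R) (hle : ∀ s t, R' s t → R s t) {s t : S}
    (hst : R' s t) : A.CT R s = A.CT R t := by
  have sub {s t : S} (hst : R' s t) : A.CT R s ⊆ A.CT R t :=
    (A.CT_subset_CT_iff R s t).2 fun δ hδ =>
      let ⟨η, hη, hl⟩ := (hR'.2 s t hst).2 δ hδ
      ⟨η, hη, hl.mono hR hR'.1 hle⟩
  exact (sub hst).antisymm (sub (hR'.1.symm hst))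

theorem PA.label_eq_and_CT_eq_of_eqvGen {S AP : Type*} [Fintype S] {A : PA S AP} {s t : S}
    (h : Relation.EqvGen A.bisimStates s t) : A.label s = A.label t ∧
      A.CT (Relation.EqvGen A.bisimStates) s = A.CT (Relation.EqvGen A.bisimStates) t := by
  induction h with
  | rel s t h =>
    obtain ⟨R', hR', hst⟩ := h
    exact ⟨(hR'.2 s t hst).1, hR'.CT_eq_of_le (Relation.EqvGen.is_equivalence _)
      (fun u v huv => .rel u v ⟨R', hR', huv⟩) hst⟩
  | refl => exact ⟨rfl, rfl⟩
  | symm _ _ _ ih => exact ⟨ih.1.symm, ih.2.symm⟩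
  | trans _ _ _ _ _ ih₁ ih₂ => exact ⟨ih₁.1.trans ih₂.1, ih₁.2.trans ih₂.2⟩

theorem PA.isBisim_eqvGen_bisimStates {S AP : Type*} [Fintype S] (A : PA S AP) :
    A.IsBisim (Relation.EqvGen A.bisimStates) :=
  ⟨Relation.EqvGen.is_equivalence _, fun s t h =>
    ⟨(label_eq_and_CT_eq_of_eqvGen h).1,
      (A.CT_subset_CT_iff _ s t).1 (label_eq_and_CT_eq_of_eqvGen h).2.subset⟩⟩

/-- for every finite-state finite-transition PA there is an equivalence
relation `R` such that `s ∼paa t` iff `R s t`, `L(s) = L(t)` and `CT_R(s) = CT_R(t)`. -/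
theorem pa_bisim_iff_same_polytope {S AP : Type*} [Fintype S]
    (A : PA S AP) (hWF : A.WF) :
    ∃ R : S → S → Prop, Equivalence R ∧
      ∀ s t : S, A.bisimStates s t ↔ (R s t ∧ A.label s = A.label t ∧ A.CT R s = A.CT R t) := by
  exact ⟨Relation.EqvGen A.bisimStates, Relation.EqvGen.is_equivalence _, fun s t =>
    ⟨fun h => ⟨.rel s t h, PA.label_eq_and_CT_eq_of_eqvGen (.rel s t h)⟩,
      fun h => ⟨_, A.isBisim_eqvGen_bisimStates, h.1⟩⟩⟩
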